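/- Consider learning with equilibrium strategies under Assumptions A1–A2 and the regularity conditions. Then almost surely there exist a random belief θ̄ ∈ Δ(S) and a random strategy profile q̄ ∈ Q such that θ^t → θ̄ and q^t → q̄; moreover, almost surely q̄ = g(θ̄) ∈ EQ(θ̄) and [θ̄] ⊆ S*(q̄), i.e., every parameter in the support of the limit belief is payoff-equivalent to s* at the limit strategy profile. -/

import Mathlib

open MeasureTheory ProbabilityTheory Filter Topology Metric

noncomputable section

/-- The probability simplex on a finite set `S`. -/
def simplex (S : Type) [Fintype S] : Set (S → ℝ) :=
  {θ | (∀ s, 0 ≤ θ s) ∧ ∑ s, θ s = 1}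

/-- The expected payoff `u_i^s(q) = ∫ c_i φ^s(c∣q) dc` of player `i` under
parameter `s`. -/
def payoff {ι S : Type} [Fintype ι] {E : ι → Type}
    (φ : S → ((i : ι) → E i) → (ι → ℝ) → ℝ) (s : S) (i : ι)
    (p : (i : ι) → E i) : ℝ :=
  ∫ x : ι → ℝ, x i * φ s p x

/-- The set of (Bayesian) Nash equilibria of the game with strategy sets `Qi`,
payoffs `u`, and belief `θ`. -/
def EQset {ι S : Type} [Fintype ι] [DecidableEq ι] [Fintype S] {E : ι → Type}
    (Qi : (i : ι) → Set (E i)) (u : S → ι → ((i : ι) → E i) → ℝ) (θ : S → ℝ) :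
    Set ((i : ι) → E i) :=
  {p | p ∈ Set.univ.pi Qi ∧ ∀ i, ∀ y ∈ Qi i,
    ∑ s, θ s * u s i (Function.update p i y) ≤ ∑ s, θ s * u s i p}

/-- Parameter `s` is payoff-equivalent to the true parameter `s*` at the strategy
profile `p`: the density `φ^{s*}(·∣p)` is absolutely continuous w.r.t. `φ^s(·∣p)` and
the KL divergence between them vanishes. -/
def PayoffEquiv {ι S : Type} [Fintype ι] {E : ι → Type}
    (φ : S → ((i : ι) → E i) → (ι → ℝ) → ℝ) (strue s : S)
    (p : (i : ι) → E i) : Prop :=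
  (∀ᵐ x ∂(volume : Measure (ι → ℝ)), φ s p x = 0 → φ strue p x = 0) ∧
  ∫ x : ι → ℝ, φ strue p x * Real.log (φ strue p x / φ s p x) = 0

/-- Static environment of the game: convex compact nonempty strategy sets, and for
each parameter a family of payoff densities on `ℝ^ι`, jointly measurable and
continuous in the strategy profile. -/
def IsGameEnv {ι S : Type} [Fintype ι] [Fintype S] {E : ι → Type}
    [∀ i, NormedAddCommGroup (E i)] [∀ i, NormedSpace ℝ (E i)]
    [∀ i, MeasurableSpace (E i)]
    (strue : S) (Qi : (i : ι) → Set (E i))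
    (φ : S → ((i : ι) → E i) → (ι → ℝ) → ℝ) : Prop :=
  (∀ i, IsCompact (Qi i) ∧ Convex ℝ (Qi i) ∧ (Qi i).Nonempty) ∧
  (∀ s : S, Measurable fun pr : ((i : ι) → E i) × (ι → ℝ) => φ s pr.1 pr.2) ∧
  (∀ (s : S) (x : ι → ℝ), ContinuousOn (fun p => φ s p x) (Set.univ.pi Qi)) ∧
  (∀ s : S, ∀ p ∈ Set.univ.pi Qi, (∀ x, 0 ≤ φ s p x) ∧ ∫ x : ι → ℝ, φ s p x = 1)

/-- A run `(θ, q, c)` of the Bayesian learning dynamics on a filtered probability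
space: the initial belief has full support, strategies are adapted with values in
`Q = ∏ Qi`, conditionally on `F t` the payoff `c t` has density `φ^{s*}(·∣q t)`, and
beliefs are updated by Bayes' rule. -/
def IsBayesProcess {ι S : Type} [Fintype ι] [Fintype S] {E : ι → Type}
    [∀ i, NormedAddCommGroup (E i)] [∀ i, NormedSpace ℝ (E i)]
    [∀ i, MeasurableSpace (E i)] {Ω : Type} [mΩ : MeasurableSpace Ω]
    (P : Measure Ω) (F : Filtration ℕ mΩ)
    (strue : S) (Qi : (i : ι) → Set (E i))
    (φ : S → ((i : ι) → E i) → (ι → ℝ) → ℝ) (θ0 : S → ℝ)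
    (θ : ℕ → Ω → S → ℝ) (q : ℕ → Ω → (i : ι) → E i) (c : ℕ → Ω → ι → ℝ) : Prop :=
  (∀ s, 0 < θ0 s) ∧ (∑ s, θ0 s = 1) ∧ (∀ ω, θ 0 ω = θ0) ∧
  (∀ t ω, q t ω ∈ Set.univ.pi Qi) ∧
  (∀ t, Measurable[F t] (q t)) ∧
  (∀ t, Measurable[F (t + 1)] (c t)) ∧
  (∀ t, Measurable[F t] (θ t)) ∧
  (∀ (t : ℕ) (g : (((i : ι) → E i) × (ι → ℝ)) → ℝ),
    Measurable g → (∀ pr, |g pr| ≤ 1) →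
    P[(fun ω => g (q t ω, c t ω))|F t]
      =ᵐ[P] fun ω => ∫ x : ι → ℝ, g (q t ω, x) * φ strue (q t ω) x) ∧
  (∀ t ω s, θ (t + 1) ω s =
    θ t ω s * φ s (q t ω) (c t ω) / ∑ s', θ t ω s' * φ s' (q t ω) (c t ω))

/-- Assumption A2 on the stepsizes: `a_i^t ∈ [0,1]` and
`∏_{t=m}^∞ (1 − a_i^t) = 0` for every player `i` and every `m`. -/
def StepsizesA2 {ι : Type} (a : ι → ℕ → ℝ) : Prop :=
  (∀ i t, a i t ∈ Set.Icc (0 : ℝ) 1) ∧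
  ∀ (i : ι) (m : ℕ), Tendsto (fun T => ∏ t ∈ Finset.Icc m T, (1 - a i t)) atTop (𝓝 0)

/-- The strategy update with equilibrium strategies:
`q_i^{t+1} = (1 − a_i^t) q_i^t + a_i^t g_i(θ^{t+1})`. -/
def IsEqUpdate {ι S : Type} {E : ι → Type}
    [∀ i, NormedAddCommGroup (E i)] [∀ i, NormedSpace ℝ (E i)] {Ω : Type}
    (a : ι → ℕ → ℝ) (g : (S → ℝ) → (i : ι) → E i)
    (θ : ℕ → Ω → S → ℝ) (q : ℕ → Ω → (i : ι) → E i) : Prop :=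
  ∀ t ω i, q (t + 1) ω i = (1 - a i t) • q t ω i + a i t • g (θ (t + 1) ω) i

/-- A conditional density tested on measurable sets determines the integral of every nonnegative
measurable function, weighted by any measurable function of the past. -/
theorem lintegral_mul_comp_of_condExp {Ω X Y : Type*} {m mΩ : MeasurableSpace Ω}
    [MeasurableSpace X] [MeasurableSpace Y] {P : Measure Ω} [IsProbabilityMeasure P]
    {ν : Measure Y} [SFinite ν] (hm : m ≤ mΩ) {Q : Ω → X} {C : Ω → Y}
    (hQ : Measurable[m] Q) (hC : Measurable C) {f : X → Y → ℝ}
    (hf : Measurable fun z : X × Y => f z.1 z.2) (hf0 : ∀ ω y, 0 ≤ f (Q ω) y)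
    (hfi : ∀ ω, Integrable (f (Q ω)) ν)
    (hcond : ∀ g : X × Y → ℝ, Measurable g → (∀ z, |g z| ≤ 1) →
      P[(fun ω => g (Q ω, C ω))|m] =ᵐ[P] fun ω => ∫ y, g (Q ω, y) * f (Q ω) y ∂ν)
    {W : Ω → ENNReal} (hW : Measurable[m] W) {h : X × Y → ENNReal} (hh : Measurable h) :
    ∫⁻ ω, W ω * h (Q ω, C ω) ∂P =
      ∫⁻ ω, W ω * ∫⁻ y, h (Q ω, y) * ENNReal.ofReal (f (Q ω) y) ∂ν ∂P := by
  have hQ' : Measurable Q := hQ.mono hm le_rfl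
  have hQC : Measurable fun ω => (Q ω, C ω) := hQ'.prodMk hC
  have hinner : ∀ h : X × Y → ENNReal, Measurable h → Measurable fun ω =>
      ∫⁻ y, h (Q ω, y) * ENNReal.ofReal (f (Q ω) y) ∂ν := fun h hh =>
    (hh.mul hf.ennreal_ofReal).lintegral_prod_right'.comp hQ'
  have hsec : ∀ h : X × Y → ENNReal, Measurable h → ∀ ω, Measurable fun y =>
      h (Q ω, y) * ENNReal.ofReal (f (Q ω) y) := fun h hh ω =>
    (hh.mul hf.ennreal_ofReal).comp measurable_prodMk_left
  have hcomp : ∀ h : X × Y → ENNReal, Measurable h → Measurable fun ω => h (Q ω, C ω) :=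
    fun h hh => hh.comp hQC
  have hset : ∀ A : Set Ω, MeasurableSet[m] A → ∀ B : Set (X × Y), MeasurableSet B →
      ∫⁻ ω in A, B.indicator 1 (Q ω, C ω) ∂P =
      ∫⁻ ω in A, ∫⁻ y, B.indicator 1 (Q ω, y) * ENNReal.ofReal (f (Q ω) y) ∂ν ∂P := by
    intro A hA B hB
    have hgm : Measurable (B.indicator (1 : X × Y → ℝ)) := measurable_one.indicator hB
    have hg0 : ∀ z, 0 ≤ B.indicator (1 : X × Y → ℝ) z := fun z =>
      Set.indicator_nonneg (fun _ _ => zero_le_one) z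
    have hg1 : ∀ z, B.indicator (1 : X × Y → ℝ) z ≤ 1 := fun z =>
      Set.indicator_le_self' (fun _ _ => zero_le_one) z
    have hgof : ∀ z, ENNReal.ofReal (B.indicator (1 : X × Y → ℝ) z) = B.indicator 1 z := by
      intro z
      by_cases hz : z ∈ B <;> simp [hz]
    have hc := hcond _ hgm fun z => by rw [abs_of_nonneg (hg0 z)]; exact hg1 z
    have hgi : Integrable (fun ω => B.indicator (1 : X × Y → ℝ) (Q ω, C ω)) P :=
      Integrable.of_bound (hgm.comp hQC).aestronglyMeasurable 1 (ae_of_all _ fun ω => by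
        rw [Real.norm_eq_abs, abs_of_nonneg (hg0 _)]; exact hg1 _)
    have hi : ∀ ω, Integrable (fun y => B.indicator (1 : X × Y → ℝ) (Q ω, y) * f (Q ω) y) ν := by
      intro ω
      refine (hfi ω).mono' (((hgm.mul hf).comp measurable_prodMk_left).aestronglyMeasurable)
        (ae_of_all _ fun y => ?_)
      rw [Real.norm_eq_abs, abs_of_nonneg (mul_nonneg (hg0 _) (hf0 ω y))]
      exact mul_le_of_le_one_left (hf0 ω y) (hg1 _)
    have hiv : ∀ ω, ENNReal.ofReal (∫ y, B.indicator (1 : X × Y → ℝ) (Q ω, y) * f (Q ω) y ∂ν) =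
        ∫⁻ y, B.indicator 1 (Q ω, y) * ENNReal.ofReal (f (Q ω) y) ∂ν := by
      intro ω
      rw [ofReal_integral_eq_lintegral_ofReal (hi ω)
        (ae_of_all _ fun y => mul_nonneg (hg0 _) (hf0 ω y))]
      simp_rw [ENNReal.ofReal_mul (hg0 _), hgof]
    have hci : Integrable (fun ω => ∫ y, B.indicator (1 : X × Y → ℝ) (Q ω, y) * f (Q ω) y ∂ν) P :=
      integrable_condExp.congr hc
    simp_rw [← hiv, ← hgof]
    rw [← ofReal_integral_eq_lintegral_ofReal hgi.integrableOn (ae_of_all _ fun _ => hg0 _),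
      ← ofReal_integral_eq_lintegral_ofReal hci.integrableOn
        (ae_of_all _ fun ω => integral_nonneg fun y => mul_nonneg (hg0 _) (hf0 ω y)),
      ← setIntegral_condExp hm hgi hA, setIntegral_congr_ae (hm A hA) (hc.mono fun x hx _ => hx)]
  have hsetA : ∀ A : Set Ω, MeasurableSet[m] A → ∀ h : X × Y → ENNReal, Measurable h →
      ∫⁻ ω in A, h (Q ω, C ω) ∂P =
      ∫⁻ ω in A, ∫⁻ y, h (Q ω, y) * ENNReal.ofReal (f (Q ω) y) ∂ν ∂P := by
    intro A hA h hh
    refine hh.ennreal_induction (motive := fun h => ∫⁻ ω in A, h (Q ω, C ω) ∂P =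
      ∫⁻ ω in A, ∫⁻ y, h (Q ω, y) * ENNReal.ofReal (f (Q ω) y) ∂ν ∂P)
      (fun a B hB => ?_) (fun f₁ f₂ _ h₁ h₂ e₁ e₂ => ?_) (fun u hu hmono e => ?_) <;>
      beta_reduce at *
    · have e : ∀ z, B.indicator (fun _ => a) z = a * B.indicator 1 z := by
        intro z
        by_cases hz : z ∈ B <;> simp [hz]
      have hB1 : Measurable (B.indicator (1 : X × Y → ENNReal)) := measurable_one.indicator hB
      simp_rw [e, mul_assoc]
      rw [lintegral_const_mul _ (hcomp _ hB1)]
      simp_rw [lintegral_const_mul _ (hsec _ hB1 _)]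
      rw [lintegral_const_mul _ (hinner _ hB1), hset A hA B hB]
    · simp only [Pi.add_apply, add_mul]
      rw [lintegral_add_left (hcomp _ h₁), e₁, e₂]
      simp_rw [lintegral_add_left (hsec _ h₁ _)]
      rw [lintegral_add_left (hinner _ h₁)]
    · simp only [ENNReal.iSup_mul]
      rw [lintegral_iSup (fun n => hcomp _ (hu n)) (fun i j hij ω => hmono hij _)]
      have : ∀ ω, ∫⁻ y, ⨆ n, u n (Q ω, y) * ENNReal.ofReal (f (Q ω) y) ∂ν =
          ⨆ n, ∫⁻ y, u n (Q ω, y) * ENNReal.ofReal (f (Q ω) y) ∂ν := fun ω =>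
        lintegral_iSup (fun n => hsec _ (hu n) ω)
          (fun i j hij y => mul_le_mul_left (hmono hij _) _)
      simp_rw [this]
      rw [lintegral_iSup (fun n => hinner _ (hu n))
        (fun i j hij ω => lintegral_mono fun y => mul_le_mul_left (hmono hij _) _)]
      simp_rw [e]
  have hWmul : ∀ w : Ω → ENNReal, Measurable[m] w → ∀ v : Ω → ENNReal, Measurable v →
      Measurable fun ω => w ω * v ω := fun w hw v hv => (hw.mono hm le_rfl).mul hv
  refine hW.ennreal_induction (motive := fun W => ∫⁻ ω, W ω * h (Q ω, C ω) ∂P =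
      ∫⁻ ω, W ω * ∫⁻ y, h (Q ω, y) * ENNReal.ofReal (f (Q ω) y) ∂ν ∂P)
    (fun a A hA => ?_) (fun f₁ f₂ _ h₁ h₂ e₁ e₂ => ?_) (fun u hu hmono e => ?_) <;>
    beta_reduce at *
  · have e : ∀ (v : Ω → ENNReal) ω, A.indicator (fun _ => a) ω * v ω =
        A.indicator (fun ω => a * v ω) ω := by
      intro v ω
      by_cases hz : ω ∈ A <;> simp [hz]
    rw [lintegral_congr (e _), lintegral_congr (e _), lintegral_indicator (hm A hA),
      lintegral_indicator (hm A hA), lintegral_const_mul _ (hcomp _ hh),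
      lintegral_const_mul _ (hinner _ hh), hsetA A hA h hh]
  · simp only [Pi.add_apply, add_mul]
    rw [lintegral_add_left (hWmul _ h₁ _ (hcomp _ hh)), e₁, e₂,
      lintegral_add_left (hWmul _ h₁ _ (hinner _ hh))]
  · simp only [ENNReal.iSup_mul]
    rw [lintegral_iSup (fun n => hWmul _ (hu n) _ (hcomp _ hh))
        (fun i j hij ω => mul_le_mul_left (hmono hij _) _),
      lintegral_iSup (fun n => hWmul _ (hu n) _ (hinner _ hh))
        (fun i j hij ω => mul_le_mul_left (hmono hij _) _)]
    simp_rw [e]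

/-- A nonnegative adapted process that is nonincreasing in conditional mean converges almost
surely. -/
theorem ae_exists_tendsto_of_setLIntegral_succ_le {Ω : Type*} {mΩ : MeasurableSpace Ω}
    {P : Measure Ω} [IsProbabilityMeasure P] {F : Filtration ℕ mΩ} {L : ℕ → Ω → ℝ}
    (hL : ∀ t, Measurable[F t] (L t)) (h0 : ∀ t ω, 0 ≤ L t ω)
    (hfin : ∫⁻ ω, ENNReal.ofReal (L 0 ω) ∂P ≠ ⊤)
    (hle : ∀ t A, MeasurableSet[F t] A →
      ∫⁻ ω in A, ENNReal.ofReal (L (t + 1) ω) ∂P ≤ ∫⁻ ω in A, ENNReal.ofReal (L t ω) ∂P) :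
    ∀ᵐ ω ∂P, ∃ l, Tendsto (fun t => L t ω) atTop (𝓝 l) := by
  have hb : ∀ t, ∫⁻ ω, ENNReal.ofReal (L t ω) ∂P ≤ ∫⁻ ω, ENNReal.ofReal (L 0 ω) ∂P := by
    intro t
    induction t with
    | zero => exact le_rfl
    | succ t ih => 
      have h := hle t Set.univ MeasurableSet.univ
      simp only [Measure.restrict_univ] at h
      exact h.trans ih
  have hmeas : ∀ t, Measurable (L t) := fun t => (hL t).mono (F.le t) le_rfl
  have hint : ∀ t, Integrable (L t) P := fun t =>
    ⟨(hmeas t).aestronglyMeasurable, by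
      rw [hasFiniteIntegral_iff_ofReal (ae_of_all _ (h0 t))]
      exact (hb t).trans_lt hfin.lt_top⟩
  have hsup : Supermartingale L F P := by
    refine supermartingale_of_setIntegral_succ_le (fun t => (hL t).stronglyMeasurable) hint ?_
    intro t A hA
    rw [integral_eq_lintegral_of_nonneg_ae (ae_of_all _ (h0 _)) (hmeas _).aestronglyMeasurable,
      integral_eq_lintegral_of_nonneg_ae (ae_of_all _ (h0 _)) (hmeas _).aestronglyMeasurable]
    refine ENNReal.toReal_mono ?_ (hle t A hA)
    exact ((setLIntegral_le_lintegral _ _).trans_lt ((hb t).trans_lt hfin.lt_top)).ne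
  have hbdd : ∀ t, eLpNorm ((-L) t) 1 P ≤
      ((∫⁻ ω, ENNReal.ofReal (L 0 ω) ∂P).toNNReal : NNReal) := by
    intro t
    rw [ENNReal.coe_toNNReal hfin, Pi.neg_apply, eLpNorm_neg, eLpNorm_one_eq_lintegral_enorm]
    refine le_trans (le_of_eq (lintegral_congr fun ω => ?_)) (hb t)
    rw [Real.enorm_eq_ofReal (h0 t ω)]
  filter_upwards [hsup.neg.exists_ae_tendsto_of_bdd hbdd] with ω ⟨l, hl⟩
  exact ⟨-l, by simpa using hl.neg⟩

/-- Conditional probabilities of adapted events that occur only finitely often tend to zero. -/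
theorem ae_tendsto_condProb_zero {Ω : Type*} {mΩ : MeasurableSpace Ω}
    {P : Measure Ω} [IsProbabilityMeasure P] {F : Filtration ℕ mΩ} {A : ℕ → Set Ω}
    (hA : ∀ t, MeasurableSet[F (t + 1)] (A t)) {b : ℕ → Ω → ℝ} (hb0 : ∀ t ω, 0 ≤ b t ω)
    (hb : ∀ t, P[(A t).indicator (1 : Ω → ℝ)|F t] =ᵐ[P] b t) :
    ∀ᵐ ω ∂P, (∀ᶠ t in atTop, ω ∉ A t) → Tendsto (fun t => b t ω) atTop (𝓝 0) := by
  let s : ℕ → Set Ω := fun n => Nat.casesOn n ∅ A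
  have hs : ∀ n, MeasurableSet[F n] (s n) := by
    intro n
    cases n with
    | zero => exact @MeasurableSet.empty _ (F 0)
    | succ n => exact hA n
  filter_upwards [ae_mem_limsup_atTop_iff P hs, ae_all_iff.2 hb] with ω hω hbω hev
  have hnot : ω ∉ limsup s atTop := by
    rw [limsup_eq_iInf_iSup_of_nat]
    simp only [Set.iInf_eq_iInter, Set.iSup_eq_iUnion, Set.mem_iInter, Set.mem_iUnion, not_forall]
    obtain ⟨N, hN⟩ := eventually_atTop.1 hev
    refine ⟨N + 1, ?_⟩
    rintro ⟨n, hn, hmem⟩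
    obtain ⟨k, rfl⟩ : ∃ k, n = k + 1 := ⟨n - 1, by omega⟩
    exact hN k (by omega) hmem
  rw [hω] at hnot
  have hsum : ∀ n, ∑ k ∈ Finset.range n, (P[(s (k + 1)).indicator (1 : Ω → ℝ) | F k]) ω =
      ∑ k ∈ Finset.range n, b k ω := fun n => Finset.sum_congr rfl fun k _ => hbω k
  simp_rw [hsum] at hnot
  have hsb : Summable fun t => b t ω := by
    by_contra hcon
    exact hnot ((not_summable_iff_tendsto_nat_atTop_of_nonneg fun t => hb0 t ω).1 hcon)
  exact hsb.tendsto_atTop_zero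

/-- Averaging with stepsizes whose residual products vanish follows a convergent target. -/
theorem tendsto_of_averaging {V : Type*} [NormedAddCommGroup V] [NormedSpace ℝ V]
    {a : ℕ → ℝ} (ha : ∀ t, a t ∈ Set.Icc (0 : ℝ) 1)
    (hprod : ∀ m, Tendsto (fun T => ∏ t ∈ Finset.Icc m T, (1 - a t)) atTop (𝓝 0))
    {x y : ℕ → V} {l : V} (hy : Tendsto y atTop (𝓝 l))
    (hx : ∀ t, x (t + 1) = (1 - a t) • x t + a t • y (t + 1)) :
    Tendsto x atTop (𝓝 l) := by
  rw [Metric.tendsto_atTop]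
  intro ε hε
  obtain ⟨m, hm⟩ := Metric.tendsto_atTop.1 hy (ε / 2) (half_pos hε)
  have hstep : ∀ t, m ≤ t → ‖x (t + 1) - l‖ - ε / 2 ≤ (1 - a t) * (‖x t - l‖ - ε / 2) := by
    intro t ht
    have h1 : x (t + 1) - l = (1 - a t) • (x t - l) + a t • (y (t + 1) - l) := by
      rw [hx]; module
    have h2 : ‖y (t + 1) - l‖ ≤ ε / 2 := by
      rw [← dist_eq_norm]; exact (hm _ (by omega)).le
    have h3 : ‖x (t + 1) - l‖ ≤ (1 - a t) * ‖x t - l‖ + a t * ‖y (t + 1) - l‖ := by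
      rw [h1]
      refine (norm_add_le _ _).trans_eq ?_
      rw [norm_smul, norm_smul, Real.norm_of_nonneg (sub_nonneg.2 (ha t).2),
        Real.norm_of_nonneg (ha t).1]
    nlinarith [mul_le_mul_of_nonneg_left h2 (ha t).1]
  have hind : ∀ T, m ≤ T → ‖x (T + 1) - l‖ - ε / 2 ≤
      (∏ t ∈ Finset.Icc m T, (1 - a t)) * (‖x m - l‖ - ε / 2) := by
    intro T hT
    induction T, hT using Nat.le_induction with
    | base => simpa using hstep m le_rfl
    | succ T hT ih =>
      rw [Finset.prod_Icc_succ_top (by omega), mul_comm (∏ _ ∈ _, _), mul_assoc]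
      exact (hstep _ (by omega)).trans
        (mul_le_mul_of_nonneg_left ih (sub_nonneg.2 (ha _).2))
  have hlim : Tendsto (fun T => (∏ t ∈ Finset.Icc m T, (1 - a t)) * (‖x m - l‖ - ε / 2))
      atTop (𝓝 0) := by simpa using (hprod m).mul_const (‖x m - l‖ - ε / 2)
  obtain ⟨N, hN⟩ := eventually_atTop.1 (hlim.eventually (gt_mem_nhds (half_pos hε)))
  refine ⟨max N m + 1, fun n hn => ?_⟩
  obtain ⟨k, rfl⟩ : ∃ k, n = k + 1 := ⟨n - 1, by omega⟩
  have h1 := hind k (by omega)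
  have h2 := hN k (by omega)
  rw [dist_eq_norm]
  linarith

/-- If the `f`-mass of the set where `h` deviates from `f` by more than a relative `ε` vanishes
along pointwise convergent densities, for all `ε`, then the limit densities agree. -/
theorem ae_eq_of_tendsto_mass_zero {Y : Type*} [MeasurableSpace Y] {ν : Measure Y}
    {f h : ℕ → Y → ℝ} {f' h' : Y → ℝ} (hfm : ∀ t, Measurable (f t)) (hhm : ∀ t, Measurable (h t))
    (hf0 : ∀ t y, 0 ≤ f t y) (hfi : ∀ t, Integrable (f t) ν)
    (hf : ∀ y, Tendsto (fun t => f t y) atTop (𝓝 (f' y)))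
    (hh : ∀ y, Tendsto (fun t => h t y) atTop (𝓝 (h' y)))
    (hhl0 : ∀ y, 0 ≤ h' y) (hfli : Integrable f' ν) (hhli : Integrable h' ν)
    (heq : ∫ y, f' y ∂ν = ∫ y, h' y ∂ν)
    (hmass : ∀ n : ℕ, Tendsto (fun t => ∫ y, {y | (1 / (n + 1) : ℝ) * f t y <
      |h t y - f t y|}.indicator (1 : Y → ℝ) y * f t y ∂ν) atTop (𝓝 0)) :
    f' =ᵐ[ν] h' := by
  have hfl0 : ∀ y, 0 ≤ f' y := fun y => ge_of_tendsto' (hf y) fun t => hf0 t y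
  have key : ∀ n : ℕ, ∀ᵐ y ∂ν, (1 / (n + 1) : ℝ) * f' y < |h' y - f' y| → f' y = 0 := by
    intro n
    set B : ℕ → Set Y := fun t => {y | (1 / (n + 1) : ℝ) * f t y < |h t y - f t y|} with hB
    have hBm : ∀ t, MeasurableSet (B t) := fun t =>
      measurableSet_lt ((hfm t).const_mul _) ((hhm t).sub (hfm t)).abs
    set u : ℕ → Y → ℝ := fun t y => (B t).indicator (1 : Y → ℝ) y * f t y with hu
    have hum : ∀ t, Measurable (u t) := fun t => (measurable_one.indicator (hBm t)).mul (hfm t)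
    have hu0 : ∀ t y, 0 ≤ u t y := fun t y =>
      mul_nonneg (Set.indicator_nonneg (fun _ _ => zero_le_one) y) (hf0 t y)
    have hui : ∀ t, Integrable (u t) ν := fun t =>
      (hfi t).mono' (hum t).aestronglyMeasurable (ae_of_all _ fun y => by
        rw [Real.norm_of_nonneg (hu0 t y)]
        exact mul_le_of_le_one_left (hf0 t y)
          (Set.indicator_le_self' (fun _ _ => zero_le_one) y))
    have hlim : Tendsto (fun t => ∫⁻ y, ENNReal.ofReal (u t y) ∂ν) atTop (𝓝 0) := by
      have := (ENNReal.continuous_ofReal.tendsto 0).comp (hmass n)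
      rw [ENNReal.ofReal_zero] at this
      refine this.congr fun t => ?_
      exact ofReal_integral_eq_lintegral_ofReal (hui t) (ae_of_all _ (hu0 t))
    have hfatou : ∫⁻ y, liminf (fun t => ENNReal.ofReal (u t y)) atTop ∂ν = 0 := by
      refine le_antisymm ?_ bot_le
      exact (lintegral_liminf_le fun t => (hum t).ennreal_ofReal).trans_eq hlim.liminf_eq
    rw [lintegral_eq_zero_iff
      (Measurable.liminf fun t => (hum t).ennreal_ofReal)] at hfatou
    filter_upwards [hfatou] with y hy hlt
    have hev : ∀ᶠ t in atTop, y ∈ B t :=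
      ((hf y).const_mul _).eventually_lt ((hh y).sub (hf y)).abs hlt
    have hconv : Tendsto (fun t => ENNReal.ofReal (u t y)) atTop (𝓝 (ENNReal.ofReal (f' y))) := by
      refine ((ENNReal.continuous_ofReal.tendsto _).comp (hf y)).congr' ?_
      filter_upwards [hev] with t ht
      simp [hu, ht]
    rw [hconv.liminf_eq] at hy
    exact le_antisymm (ENNReal.ofReal_eq_zero.1 hy) (hfl0 y)
  have hle : f' ≤ᵐ[ν] h' := by
    filter_upwards [ae_all_iff.2 key] with y hy
    rcases (hfl0 y).eq_or_lt with h0 | h0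
    · rw [← h0]; exact hhl0 y
    · refine le_of_eq ?_
      by_contra hne
      have hd : 0 < |h' y - f' y| := abs_pos.2 (sub_ne_zero.2 (Ne.symm hne))
      obtain ⟨n, hn⟩ := exists_nat_one_div_lt (div_pos hd h0)
      exact h0.ne' (hy n ((lt_div_iff₀ h0).1 hn))
  exact (integral_eq_iff_of_ae_le hfli hhli hle).1 heq

/-- **Convergence of learning with equilibrium strategies (Theorem 1).**
Under Assumption A1 (a continuous equilibrium selection `g`), Assumption A2 on the
stepsizes, and the regularity conditions on the densities, the beliefs and strategies
converge a.s. to a fixed point `(θ̄, q̄)`: `q̄ = g(θ̄) ∈ EQ(θ̄)` and every parameter in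
the support of `θ̄` is payoff-equivalent to `s*` at `q̄`. -/
theorem convergence_eq_learning {ι S : Type} [Fintype ι] [DecidableEq ι] [Fintype S]
    {E : ι → Type} [∀ i, NormedAddCommGroup (E i)] [∀ i, NormedSpace ℝ (E i)]
    [∀ i, MeasurableSpace (E i)] [∀ i, BorelSpace (E i)]
    {Ω : Type} [mΩ : MeasurableSpace Ω]
    (P : Measure Ω) [IsProbabilityMeasure P] (F : Filtration ℕ mΩ)
    (strue : S) (Qi : (i : ι) → Set (E i))
    (φ : S → ((i : ι) → E i) → (ι → ℝ) → ℝ)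
    (henv : IsGameEnv strue Qi φ)
    -- Assumption A1: continuous equilibrium selection
    (g : (S → ℝ) → (i : ι) → E i)
    (hg_cont : ContinuousOn g (simplex S))
    (hg_eq : ∀ ϑ ∈ simplex S, g ϑ ∈ EQset Qi (payoff φ) ϑ)
    -- Assumption A2: stepsizes
    (a : ι → ℕ → ℝ) (hA2 : StepsizesA2 a)
    -- the learning dynamics
    (θ0 : S → ℝ) (θ : ℕ → Ω → S → ℝ) (q : ℕ → Ω → (i : ι) → E i)
    (c : ℕ → Ω → ι → ℝ)
    (hproc : IsBayesProcess P F strue Qi φ θ0 θ q c)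
    (hupd : IsEqUpdate a g θ q)
    -- regularity condition (i)
    (hreg1 : ∀ s : S, ContinuousOn
      (fun p => ∫ x : ι → ℝ, Set.indicator {x | φ s p x = 0} (φ strue p) x)
      (Set.univ.pi Qi))
    -- regularity condition (ii): finiteness and continuity of the KL divergence and a
    -- uniform second-moment bound on the set of profiles where `φ^{s*} ≪ φ^s`
    (hreg2fin : ∀ s : S,
      ∀ p ∈ {p | p ∈ Set.univ.pi Qi ∧
          ∀ᵐ x ∂(volume : Measure (ι → ℝ)), φ s p x = 0 → φ strue p x = 0},
        Integrable (fun x : ι → ℝ => φ strue p x * Real.log (φ strue p x / φ s p x)))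
    (hreg2cont : ∀ s : S, ContinuousOn
      (fun p => ∫ x : ι → ℝ, φ strue p x * Real.log (φ strue p x / φ s p x))
      {p | p ∈ Set.univ.pi Qi ∧
        ∀ᵐ x ∂(volume : Measure (ι → ℝ)), φ s p x = 0 → φ strue p x = 0})
    (hreg2mom : ∀ s : S, ∃ C : ℝ,
      ∀ p ∈ {p | p ∈ Set.univ.pi Qi ∧
          ∀ᵐ x ∂(volume : Measure (ι → ℝ)), φ s p x = 0 → φ strue p x = 0},
        ∫ x : ι → ℝ, (Real.log (φ s p x / φ strue p x)) ^ 2 * φ strue p x ≤ C) :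
    ∃ (θbar : Ω → S → ℝ) (qbar : Ω → (i : ι) → E i), ∀ᵐ ω ∂P,
      θbar ω ∈ simplex S ∧
      Tendsto (fun t => θ t ω) atTop (𝓝 (θbar ω)) ∧
      Tendsto (fun t => q t ω) atTop (𝓝 (qbar ω)) ∧
      qbar ω = g (θbar ω) ∧
      qbar ω ∈ EQset Qi (payoff φ) (θbar ω) ∧
      ∀ s, 0 < θbar ω s → PayoffEquiv φ strue s (qbar ω) := by
  obtain ⟨-, hφm, hφc, hφd⟩ := henv
  obtain ⟨hθ0, hsum0, hinit, hqQ, hqm, hcm, hθm, hcond, hbayes⟩ := hproc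
  have hφi : ∀ s, ∀ p ∈ Set.univ.pi Qi, Integrable (φ s p) := by
    intro s p hp
    by_contra hcon
    have := (hφd s p hp).2
    rw [integral_undef hcon] at this
    exact zero_ne_one this
  have hφnn : ∀ s t ω x, 0 ≤ φ s (q t ω) x := fun s t ω => (hφd s _ (hqQ t ω)).1
  have hsec : ∀ s p, Measurable (φ s p) := fun s p => (hφm s).comp measurable_prodMk_left
  have hθnn : ∀ t ω s, 0 ≤ θ t ω s := by
    intro t
    induction t with
    | zero => intro ω s; rw [hinit]; exact (hθ0 s).le
    | succ t ih =>
      intro ω s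
      rw [hbayes]
      exact div_nonneg (mul_nonneg (ih ω s) (hφnn _ _ _ _))
        (Finset.sum_nonneg fun s' _ => mul_nonneg (ih ω s') (hφnn _ _ _ _))
  have hlaw : ∀ t (W : Ω → ENNReal), Measurable[F t] W →
      ∀ h : ((i : ι) → E i) × (ι → ℝ) → ENNReal, Measurable h →
      ∫⁻ ω, W ω * h (q t ω, c t ω) ∂P =
        ∫⁻ ω, W ω * (∫⁻ x, h (q t ω, x) * ENNReal.ofReal (φ strue (q t ω) x)) ∂P :=
    fun t W hW h hh => lintegral_mul_comp_of_condExp (F.le t) (hqm t)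
      ((hcm t).mono (F.le _) le_rfl) (hφm strue) (hφnn strue t)
      (fun ω => hφi strue _ (hqQ t ω)) (hcond t) hW hh
  have hqc : ∀ t, Measurable[F (t + 1)] fun ω => (q t ω, c t ω) := fun t =>
    ((hqm t).mono (F.mono (Nat.le_succ t)) le_rfl).prodMk (hcm t)
  have hpos : ∀ᵐ ω ∂P, ∀ t, 0 < φ strue (q t ω) (c t ω) := by
    refine ae_all_iff.2 fun t => ?_
    set N : Set (((i : ι) → E i) × (ι → ℝ)) := {z | φ strue z.1 z.2 = 0} with hN
    have hNm : MeasurableSet N := hφm strue (measurableSet_singleton 0)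
    have hNi : Measurable (N.indicator (1 : ((i : ι) → E i) × (ι → ℝ) → ENNReal)) :=
      measurable_one.indicator hNm
    have h0 := hlaw t (fun _ => 1) measurable_const _ hNi
    have hz : ∀ ω x, N.indicator (1 : ((i : ι) → E i) × (ι → ℝ) → ENNReal) (q t ω, x) *
        ENNReal.ofReal (φ strue (q t ω) x) = 0 := by
      intro ω x
      by_cases hx : φ strue (q t ω) x = 0
      · simp [hx]
      · simp [hN, hx]
    simp only [hz, lintegral_zero, mul_zero, one_mul] at h0
    have hNc : Measurable fun ω => N.indicator (1 : ((i : ι) → E i) × (ι → ℝ) → ENNReal)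
        (q t ω, c t ω) := hNi.comp ((hqc t).mono (F.le _) le_rfl)
    rw [lintegral_eq_zero_iff hNc] at h0
    filter_upwards [h0] with ω hω
    refine (hφnn strue t ω _).lt_of_ne' fun hcon => ?_
    have hmem : (q t ω, c t ω) ∈ N := hcon
    simp [hmem] at hω
  set L : S → ℕ → Ω → ℝ := fun s t ω => θ t ω s / θ t ω strue with hL
  have hLsucc : ∀ s t ω, L s (t + 1) ω =
      L s t ω * (φ s (q t ω) (c t ω) / φ strue (q t ω) (c t ω)) := by
    intro s t ω
    simp only [hL, hbayes]
    by_cases hZ : ∑ s', θ t ω s' * φ s' (q t ω) (c t ω) = 0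
    · have := (Finset.sum_eq_zero_iff_of_nonneg fun s' _ =>
        mul_nonneg (hθnn t ω s') (hφnn s' t ω _)).1 hZ strue (Finset.mem_univ _)
      rcases mul_eq_zero.1 this with h | h <;> simp [hZ, h]
    · rw [div_div_div_cancel_right₀ hZ, div_mul_div_comm]
  have hLnn : ∀ s t ω, 0 ≤ L s t ω := fun s t ω => div_nonneg (hθnn _ _ _) (hθnn _ _ _)
  have hLm : ∀ s t, Measurable[F t] (L s t) := fun s t =>
    ((measurable_pi_apply s).comp (hθm t)).div ((measurable_pi_apply strue).comp (hθm t))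
  have hLconv : ∀ᵐ ω ∂P, ∀ s, ∃ l, Tendsto (fun t => L s t ω) atTop (𝓝 l) := by
    refine ae_all_iff.2 fun s =>
      ae_exists_tendsto_of_setLIntegral_succ_le (hLm s) (hLnn s) ?_ fun t A hA => ?_
    · simp [hL, hinit]
    · have hAm := F.le t A hA
      rw [← lintegral_indicator hAm, ← lintegral_indicator hAm]
      set h : ((i : ι) → E i) × (ι → ℝ) → ENNReal := fun z =>
        ENNReal.ofReal (φ s z.1 z.2 / φ strue z.1 z.2) with hh
      have hhm : Measurable h := ((hφm s).div (hφm strue)).ennreal_ofReal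
      have hWm : Measurable[F t] (A.indicator fun ω => ENNReal.ofReal (L s t ω)) :=
        (hLm s t).ennreal_ofReal.indicator hA
      calc ∫⁻ ω, A.indicator (fun ω => ENNReal.ofReal (L s (t + 1) ω)) ω ∂P
          = ∫⁻ ω, A.indicator (fun ω => ENNReal.ofReal (L s t ω)) ω * h (q t ω, c t ω) ∂P := by
            refine lintegral_congr fun ω => ?_
            by_cases hω : ω ∈ A
            · simp [hω, hLsucc, hh, ENNReal.ofReal_mul (hLnn s t ω)]
            · simp [hω]
        _ = ∫⁻ ω, A.indicator (fun ω => ENNReal.ofReal (L s t ω)) ω *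
              (∫⁻ x, h (q t ω, x) * ENNReal.ofReal (φ strue (q t ω) x)) ∂P :=
            hlaw t _ hWm h hhm
        _ ≤ ∫⁻ ω, A.indicator (fun ω => ENNReal.ofReal (L s t ω)) ω ∂P := by
            refine lintegral_mono fun ω => mul_le_of_le_one_right' ?_
            calc ∫⁻ x, h (q t ω, x) * ENNReal.ofReal (φ strue (q t ω) x)
                ≤ ∫⁻ x, ENNReal.ofReal (φ s (q t ω) x) := by
                  refine lintegral_mono fun x => ?_
                  rw [hh, ← ENNReal.ofReal_mul (div_nonneg (hφnn _ _ _ _) (hφnn _ _ _ _))]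
                  refine ENNReal.ofReal_le_ofReal ?_
                  rcases eq_or_ne (φ strue (q t ω) x) 0 with h0 | h0
                  · simpa [h0] using hφnn s t ω x
                  · exact (div_mul_cancel₀ _ h0).le
              _ = 1 := by
                  rw [← ofReal_integral_eq_lintegral_ofReal (hφi s _ (hqQ t ω))
                    (ae_of_all _ (hφnn s t ω)), (hφd s _ (hqQ t ω)).2, ENNReal.ofReal_one]
  set B : S → ℕ → Set (((i : ι) → E i) × (ι → ℝ)) := fun s n =>
    {z | (1 / (n + 1) : ℝ) * φ strue z.1 z.2 < |φ s z.1 z.2 - φ strue z.1 z.2|} with hB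
  have hBm : ∀ s n, MeasurableSet (B s n) := fun s n =>
    measurableSet_lt ((hφm strue).const_mul _) (continuous_abs.measurable.comp
      ((hφm s).sub (hφm strue)))
  have hfew : ∀ᵐ ω ∂P, ∀ s n, (∀ᶠ t in atTop, (q t ω, c t ω) ∉ B s n) →
      Tendsto (fun t => ∫ x, (B s n).indicator (1 : ((i : ι) → E i) × (ι → ℝ) → ℝ) (q t ω, x) *
        φ strue (q t ω) x) atTop (𝓝 0) := by
    refine ae_all_iff.2 fun s => ae_all_iff.2 fun n => ?_
    have hind : ∀ z, 0 ≤ (B s n).indicator (1 : ((i : ι) → E i) × (ι → ℝ) → ℝ) z := fun z =>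
      Set.indicator_nonneg (fun _ _ => zero_le_one) z
    exact ae_tendsto_condProb_zero (A := fun t => {ω | (q t ω, c t ω) ∈ B s n})
      (b := fun t ω => ∫ x, (B s n).indicator (1 : ((i : ι) → E i) × (ι → ℝ) → ℝ) (q t ω, x) *
        φ strue (q t ω) x)
      (fun t => hqc t (hBm s n))
      (fun t ω => integral_nonneg fun x => mul_nonneg (hind _) (hφnn _ _ _ _))
      fun t => hcond t _ (measurable_one.indicator (hBm s n)) fun z => by
        rw [abs_of_nonneg (hind z)]
        exact Set.indicator_le_self' (fun _ _ => zero_le_one) z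
  have hmain : ∀ᵐ ω ∂P, ∃ ϑ : S → ℝ, ϑ ∈ simplex S ∧ Tendsto (fun t => θ t ω) atTop (𝓝 ϑ) ∧
      Tendsto (fun t => q t ω) atTop (𝓝 (g ϑ)) ∧
      ∀ s, 0 < ϑ s → PayoffEquiv φ strue s (g ϑ) := by
    filter_upwards [hpos, hLconv, hfew] with ω hposω hconv hfewω
    have hθ : ∀ t, 0 < θ t ω strue ∧ ∑ s, θ t ω s = 1 := by
      intro t
      induction t with
      | zero => rw [hinit]; exact ⟨hθ0 _, hsum0⟩
      | succ t ih =>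
        have hZ : 0 < ∑ s', θ t ω s' * φ s' (q t ω) (c t ω) :=
          Finset.sum_pos' (fun s' _ => mul_nonneg (hθnn t ω s') (hφnn s' t ω _))
            ⟨strue, Finset.mem_univ _, mul_pos ih.1 (hposω t)⟩
        refine ⟨by rw [hbayes]; exact div_pos (mul_pos ih.1 (hposω t)) hZ, ?_⟩
        simp_rw [hbayes]
        rw [← Finset.sum_div, div_self hZ.ne']
    have hmem : ∀ t, θ t ω ∈ simplex S := fun t => ⟨hθnn t ω, (hθ t).2⟩
    choose l hl using hconv
    have hl0 : ∀ s, 0 ≤ l s := fun s => ge_of_tendsto' (hl s) fun t => hLnn s t ω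
    have hLsum : ∀ t, (∑ s, L s t ω)⁻¹ = θ t ω strue := by
      intro t
      simp only [hL]
      rw [← Finset.sum_div, (hθ t).2, one_div, inv_inv]
    have hlsum : Tendsto (fun t => ∑ s, L s t ω) atTop (𝓝 (∑ s, l s)) :=
      tendsto_finsetSum _ fun s _ => hl s
    have hlstrue : l strue = 1 := by
      refine tendsto_nhds_unique (hl strue) (tendsto_const_nhds.congr fun t => ?_)
      exact (div_self (hθ t).1.ne').symm
    have hspos : 0 < ∑ s, l s :=
      Finset.sum_pos' (fun s _ => hl0 s) ⟨strue, Finset.mem_univ _, by rw [hlstrue]; exact one_pos⟩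
    set ϑ : S → ℝ := fun s => l s * (∑ s, l s)⁻¹ with hϑ
    have hθlim : Tendsto (fun t => θ t ω) atTop (𝓝 ϑ) := by
      refine tendsto_pi_nhds.2 fun s => ?_
      refine ((hl s).mul (hlsum.inv₀ hspos.ne')).congr fun t => ?_
      rw [hLsum]
      exact div_mul_cancel₀ _ (hθ t).1.ne'
    have hϑmem : ϑ ∈ simplex S :=
      ⟨fun s => mul_nonneg (hl0 s) (inv_nonneg.2 hspos.le), by
        rw [hϑ, ← Finset.sum_mul, mul_inv_cancel₀ hspos.ne']⟩
    have hglim : Tendsto (fun t => g (θ t ω)) atTop (𝓝 (g ϑ)) :=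
      (hg_cont ϑ hϑmem).tendsto.comp
        (tendsto_nhdsWithin_iff.2 ⟨hθlim, Eventually.of_forall hmem⟩)
    have hqlim : Tendsto (fun t => q t ω) atTop (𝓝 (g ϑ)) :=
      tendsto_pi_nhds.2 fun i => tendsto_of_averaging (hA2.1 i) (hA2.2 i)
        (tendsto_pi_nhds.1 hglim i) fun t => hupd t ω i
    refine ⟨ϑ, hϑmem, hθlim, hqlim, fun s hs => ?_⟩
    have hgQ : g ϑ ∈ Set.univ.pi Qi := (hg_eq ϑ hϑmem).1
    have hls : 0 < l s := (hl0 s).lt_of_ne' fun h => by simp [hϑ, h] at hs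
    have hratio : Tendsto (fun t => φ s (q t ω) (c t ω) / φ strue (q t ω) (c t ω))
        atTop (𝓝 1) := by
      have h1 := ((hl s).comp (tendsto_add_atTop_nat 1)).div (hl s) hls.ne'
      rw [div_self hls.ne'] at h1
      refine h1.congr' ?_
      filter_upwards [(hl s).eventually (lt_mem_nhds hls)] with t ht
      simp only [Function.comp_apply, Pi.div_apply, hLsucc]
      exact mul_div_cancel_left₀ _ ht.ne'
    have hφlim : ∀ s x, Tendsto (fun t => φ s (q t ω) x) atTop (𝓝 (φ s (g ϑ) x)) := fun s x =>
      (hφc s x _ hgQ).tendsto.comp (tendsto_nhdsWithin_iff.2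
        ⟨hqlim, Eventually.of_forall fun t => hqQ t ω⟩)
    have hae : φ strue (g ϑ) =ᵐ[volume] φ s (g ϑ) := by
      refine ae_eq_of_tendsto_mass_zero (f := fun t => φ strue (q t ω))
        (h := fun t => φ s (q t ω)) (fun t => hsec _ _) (fun t => hsec _ _)
        (hφnn strue · ω) (fun t => hφi _ _ (hqQ t ω)) (hφlim strue) (hφlim s)
        (hφd s _ hgQ).1 (hφi _ _ hgQ) (hφi _ _ hgQ)
        (by rw [(hφd s _ hgQ).2, (hφd strue _ hgQ).2]) fun n => ?_
      refine hfewω s n ?_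
      have hev := Metric.tendsto_atTop.1 hratio (1 / (n + 1)) Nat.one_div_pos_of_nat
      obtain ⟨N, hN⟩ := hev
      filter_upwards [eventually_ge_atTop N] with t ht
      have h1 := hN t ht
      have hp := hposω t
      rw [Real.dist_eq, div_sub_one hp.ne', abs_div, abs_of_pos hp, div_lt_iff₀ hp] at h1
      exact not_lt.2 h1.le
    refine ⟨hae.mono fun x hx h0 => hx.trans h0, ?_⟩
    refine integral_eq_zero_of_ae (hae.mono fun x hx => ?_)
    by_cases h0 : φ s (g ϑ) x = 0
    · simp [hx, h0]
    · simp [hx, div_self h0]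
  obtain ⟨θbar, hbar⟩ := hmain.choice
  refine ⟨θbar, fun ω => g (θbar ω), hbar.mono fun ω ⟨h1, h2, h3, h4⟩ => ?_⟩
  exact ⟨h1, h2, h3, rfl, hg_eq _ h1, h4⟩
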